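/- arXiv:2402.07866 — 2 statements merged into one kernel-verified Lean document; each statement's English description precedes it below -/
import Mathlib

section
/- Let d ≥ 1 and let E : Fin K → Matrix (Fin d) (Fin d) ℂ satisfy Tr(E i * (E j)ᴴ) = d·δ_{ij}, with each E_i unitary ((E_i)ᴴ * E_i = 1). Let p : Fin K → ℝ be nonnegative with P_M := ∑_i p_i^M > 0, and let ρ be a matrix with Tr ρ = 1. Then for every matrix O and every M ≥ 1, the ratio of circuit expectation values satisfies (∑ over tuples (i₁,…,i_M) of (∏_m p_{i_m}) Tr(E_{i_M} ρ (E_{i_1})ᴴ O) ∏_{m=1}^{M-1} d⁻¹ Tr(E_{i_m}(E_{i_{m+1}})ᴴ)) / (∑ over tuples (i₁,…,i_M) of (∏_m p_{i_m}) Tr(E_{i_M} ρ (E_{i_1})ᴴ) ∏_{m=1}^{M-1} d⁻¹ Tr(E_{i_m}(E_{i_{m+1}})ᴴ)) = P_M⁻¹ ∑_i p_i^M Tr(O · E_i ρ (E_i)ᴴ), i.e. it equals Tr[O ℰ^{(M)}(ρ)] for the purified channel ℰ^{(M)}(ρ) = P_M⁻¹ ∑_i p_i^M E_i ρ E_iᴴ.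 -/
open Matrix BigOperators

theorem Fin.eq_zero_of_castSucc_eq_succ {α : Type*} {n : ℕ} {f : Fin (n + 1) → α}
    (h : ∀ m : Fin n, f m.castSucc = f m.succ) (m : Fin (n + 1)) : f m = f 0 := by
  induction m using Fin.induction with
  | zero => rfl
  | succ m ih => rw [← h m, ih]

/-- A chain of Kronecker deltas collapses a sum over tuples to the constant tuples. -/
theorem sum_mul_prod_ite_castSucc_eq_succ {α R : Type*} [Fintype α] [DecidableEq α]
    [CommSemiring R] {n : ℕ} (F : (Fin (n + 1) → α) → R) :
    ∑ f : Fin (n + 1) → α, F f * ∏ m : Fin n, (if f m.castSucc = f m.succ then 1 else 0) =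
      ∑ i, F fun _ => i := by
  symm
  refine Finset.sum_of_injOn (fun i _ => i) (fun i _ j _ h => congrFun h 0) (by simp) ?_ (by simp)
  intro f _ hf
  by_cases h : ∀ m : Fin n, f m.castSucc = f m.succ
  · refine absurd ⟨f 0, by simp, ?_⟩ hf
    funext m
    exact (Fin.eq_zero_of_castSucc_eq_succ h m).symm
  · obtain ⟨m, hm⟩ := not_forall.mp h
    rw [Finset.prod_eq_zero (Finset.mem_univ m) (if_neg hm), mul_zero]

/-- Theorem 1 of the paper: the ratio of VCP circuit expectation values
`⟨X ⊗ O⟩ / ⟨X ⊗ I⟩` equals `Tr[O ℰ^(M)(ρ)]`, with `M = n + 1 ≥ 1`. -/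
theorem vcp_ratio_is_purified_channel
    (d K : ℕ) (hd : 1 ≤ d)
    (E : Fin K → Matrix (Fin d) (Fin d) ℂ)
    (horth : ∀ i j, (E i * (E j)ᴴ).trace = if i = j then (d : ℂ) else 0)
    (hunit : ∀ i, (E i)ᴴ * E i = 1)
    (p : Fin K → ℝ) (hp : ∀ i, 0 ≤ p i)
    (n : ℕ) (hP : 0 < ∑ i, p i ^ (n + 1))
    (ρ : Matrix (Fin d) (Fin d) ℂ) (hρ : ρ.trace = 1)
    (O : Matrix (Fin d) (Fin d) ℂ) :
    (∑ f : Fin (n + 1) → Fin K,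
      (∏ m, (p (f m) : ℂ)) *
        (E (f (Fin.last n)) * ρ * (E (f 0))ᴴ * O).trace *
        ∏ m : Fin n, (d : ℂ)⁻¹ * (E (f m.castSucc) * (E (f m.succ))ᴴ).trace) /
    (∑ f : Fin (n + 1) → Fin K,
      (∏ m, (p (f m) : ℂ)) *
        (E (f (Fin.last n)) * ρ * (E (f 0))ᴴ).trace *
        ∏ m : Fin n, (d : ℂ)⁻¹ * (E (f m.castSucc) * (E (f m.succ))ᴴ).trace)
    = ((∑ i, p i ^ (n + 1) : ℝ) : ℂ)⁻¹ *
        ∑ i, (p i : ℂ) ^ (n + 1) * (O * (E i * ρ * (E i)ᴴ)).trace := by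
  have hd0 : (d : ℂ) ≠ 0 := Nat.cast_ne_zero.mpr (by omega)
  have hdelta : ∀ i j, (d : ℂ)⁻¹ * (E i * (E j)ᴴ).trace = if i = j then 1 else 0 := by
    intro i j
    rw [horth, mul_ite, inv_mul_cancel₀ hd0, mul_zero]
  have htrace : ∀ i, (E i * ρ * (E i)ᴴ).trace = 1 := by
    intro i
    rw [trace_mul_comm, ← Matrix.mul_assoc, hunit, Matrix.one_mul, hρ]
  simp only [hdelta]
  rw [sum_mul_prod_ite_castSucc_eq_succ
      fun f => (∏ m, (p (f m) : ℂ)) * (E (f (Fin.last n)) * ρ * (E (f 0))ᴴ * O).trace,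
    sum_mul_prod_ite_castSucc_eq_succ
      fun f => (∏ m, (p (f m) : ℂ)) * (E (f (Fin.last n)) * ρ * (E (f 0))ᴴ).trace]
  simp only [Finset.prod_const, Finset.card_univ, Fintype.card_fin, htrace, mul_one,
    trace_mul_comm _ O]
  push_cast
  rw [div_eq_inv_mul]
end

section
/- Let d ≥ 1, let E : Fin K → Matrix (Fin d) (Fin d) ℂ, and let p : Fin K → ℝ. Suppose for each m ∈ {1,…,M−1} we are given matrices σ_m and S_m in Matrix (Fin d) (Fin d) ℂ satisfying the purification condition Tr(S_m · E_i · σ_m · (E_j)ᴴ) = δ_{ij} for all i, j ∈ Fin K. Then for all matrices ρ, O: ∑ over tuples (i₁,…,i_M) ∈ (Fin K)^M of (∏_{m=1}^M p_{i_m}) · Tr(E_{i_M} ρ (E_{i_1})ᴴ O) · ∏_{m=1}^{M-1} Tr(S_m E_{i_m} σ_m (E_{i_{m+1}})ᴴ) = ∑_i p_i^M · Tr(E_i ρ (E_i)ᴴ O). -/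
open Matrix BigOperators

/-- A function on `Fin (n + 1)` whose consecutive values agree is constant. -/
theorem Fin.eq_const_of_castSucc_eq_succ {α : Type*} {n : ℕ} {f : Fin (n + 1) → α}
    (h : ∀ m : Fin n, f m.castSucc = f m.succ) : f = fun _ => f 0 := by
  funext m
  induction m using Fin.induction with
  | zero => rfl
  | succ k ih => rw [← h k, ih]

/-- Generalized VCP circuit with ancillary input states `σ m` and measurements `S m`
satisfying the purification condition: the circuit expectation value
`⟨X ⊗ (⊗ₘ Sₘ) ⊗ O⟩` equals `∑ᵢ pᵢ^M Tr(Eᵢ ρ Eᵢᴴ O)`, with `M = n + 1 ≥ 1`. -/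
theorem generalized_vcp_expectation
    (d K n : ℕ) (hd : 1 ≤ d)
    (E : Fin K → Matrix (Fin d) (Fin d) ℂ)
    (p : Fin K → ℝ)
    (σ S : Fin n → Matrix (Fin d) (Fin d) ℂ)
    (hpur : ∀ m i j, (S m * E i * σ m * (E j)ᴴ).trace = if i = j then 1 else 0)
    (ρ O : Matrix (Fin d) (Fin d) ℂ) :
    ∑ f : Fin (n + 1) → Fin K,
      (∏ m, (p (f m) : ℂ)) *
        (E (f (Fin.last n)) * ρ * (E (f 0))ᴴ * O).trace *
        ∏ m : Fin n, (S m * E (f m.castSucc) * σ m * (E (f m.succ))ᴴ).trace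
      = ∑ i, (p i : ℂ) ^ (n + 1) * (E i * ρ * (E i)ᴴ * O).trace := by
  simp only [hpur]
  symm
  refine Finset.sum_of_injOn (fun i _ => i) (fun i _ j _ h => congrFun h 0)
    (by simp) (fun f _ hf => ?_) (fun i _ => by simp)
  obtain ⟨m, hm⟩ : ∃ m : Fin n, f m.castSucc ≠ f m.succ := by
    by_contra! h
    exact hf ⟨f 0, by simp, (Fin.eq_const_of_castSucc_eq_succ h).symm⟩
  rw [Finset.prod_eq_zero (Finset.mem_univ m) (if_neg hm), mul_zero]
end
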